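/- Unbiasedness of the Cramér distance (strong form): let P, Q be probability measures on ℝ with finite first moments, let X₁, …, X_m be i.i.d. samples from P, and let F̂_m(x) = (1/m)∑ᵢ 1{Xᵢ ≤ x}. Then E[∫_ℝ (F̂_m(x) − F_Q(x))² dx] = ∫_ℝ (F_P(x) − F_Q(x))² dx + (1/m) ∫_ℝ F_P(x)(1 − F_P(x)) dx, and all three integrals are finite. In particular, the expected sample Cramér loss differs from the true Cramér loss by a term independent of Q, so the Cramér distance has unbiased sample gradients. -/

import Mathlib

open MeasureTheory
open scoped ENNReal

/-- The cumulative distribution function of a measure on `ℝ`. -/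
noncomputable def cdf' (P : Measure ℝ) (x : ℝ) : ℝ :=
  (P (Set.Iic x)).toReal

/-- The empirical distribution function `F̂_m(x) = (1/m) ∑ᵢ 1{Xᵢ ≤ x}`. -/
noncomputable def empCDF {m : ℕ} (X : Fin m → ℝ) (x : ℝ) : ℝ :=
  (1 / m : ℝ) * ∑ i, (if X i ≤ x then (1:ℝ) else 0)

section

open ProbabilityTheory

lemma measurable_ite_le : Measurable fun z : ℝ × ℝ => if z.1 ≤ z.2 then (1 : ℝ) else 0 :=
  Measurable.ite (measurableSet_le measurable_fst measurable_snd) measurable_const measurable_const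

lemma measurable_ite_le_left (x : ℝ) : Measurable fun y : ℝ => if y ≤ x then (1 : ℝ) else 0 :=
  measurable_ite_le.comp (measurable_id.prodMk measurable_const)

lemma memLp_ite_le (P : Measure ℝ) [IsFiniteMeasure P] (x : ℝ) :
    MemLp (fun y : ℝ => if y ≤ x then (1 : ℝ) else 0) 2 P :=
  MemLp.of_bound (measurable_ite_le_left x).aestronglyMeasurable 1
    (ae_of_all _ fun y => by split_ifs <;> simp)

lemma integrable_ite_le (P : Measure ℝ) [IsFiniteMeasure P] (x : ℝ) :
    Integrable (fun y : ℝ => if y ≤ x then (1 : ℝ) else 0) P :=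
  (memLp_ite_le P x).integrable one_le_two

lemma integral_ite_le (P : Measure ℝ) (x : ℝ) :
    ∫ y, (if y ≤ x then (1 : ℝ) else 0) ∂P = cdf' P x := by
  have h : (fun y : ℝ => if y ≤ x then (1 : ℝ) else 0) = (Set.Iic x).indicator 1 := by
    ext y
    simp [Set.indicator_apply]
  rw [h, integral_indicator_one measurableSet_Iic]
  rfl

lemma variance_ite_le (P : Measure ℝ) [IsProbabilityMeasure P] (x : ℝ) :
    variance (fun y : ℝ => if y ≤ x then (1 : ℝ) else 0) P = cdf' P x * (1 - cdf' P x) := by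
  have h : (fun y : ℝ => if y ≤ x then (1 : ℝ) else 0) ^ 2
      = fun y : ℝ => if y ≤ x then (1 : ℝ) else 0 := by
    ext y
    simp
  rw [variance_eq_sub (memLp_ite_le P x), h, integral_ite_le]
  ring

lemma cdf'_nonneg (P : Measure ℝ) (x : ℝ) : 0 ≤ cdf' P x := ENNReal.toReal_nonneg

lemma cdf'_le_one (P : Measure ℝ) [IsProbabilityMeasure P] (x : ℝ) : cdf' P x ≤ 1 :=
  measureReal_le_one

lemma monotone_cdf' (P : Measure ℝ) [IsFiniteMeasure P] : Monotone (cdf' P) :=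
  fun _ _ h => measureReal_mono (Set.Iic_subset_Iic.2 h)

lemma measurable_uncurry_empCDF (m : ℕ) :
    Measurable fun z : (Fin m → ℝ) × ℝ => empCDF z.1 z.2 := by
  unfold empCDF
  refine (Finset.measurable_sum _ fun i _ => ?_).const_mul _
  have h : Measurable fun z : (Fin m → ℝ) × ℝ => (z.1 i, z.2) := by fun_prop
  exact measurable_ite_le.comp h

lemma memLp_ite_le_eval (P : Measure ℝ) [IsProbabilityMeasure P] {m : ℕ} (i : Fin m) (x : ℝ) :
    MemLp (fun X : Fin m → ℝ => if X i ≤ x then (1 : ℝ) else 0) 2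
      (Measure.pi fun _ : Fin m => P) :=
  (memLp_ite_le P x).comp_measurePreserving (measurePreserving_eval (fun _ : Fin m => P) i)

lemma memLp_empCDF (P : Measure ℝ) [IsProbabilityMeasure P] (m : ℕ) (x : ℝ) :
    MemLp (fun X : Fin m → ℝ => empCDF X x) 2 (Measure.pi fun _ : Fin m => P) :=
  (memLp_finsetSum _ fun i _ => memLp_ite_le_eval P i x).const_mul _

lemma integral_empCDF (P : Measure ℝ) [IsProbabilityMeasure P] {m : ℕ} (hm : m ≠ 0) (x : ℝ) :
    ∫ X, empCDF X x ∂(Measure.pi fun _ : Fin m => P) = cdf' P x := by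
  have h (i : Fin m) : ∫ X : Fin m → ℝ, (if X i ≤ x then (1 : ℝ) else 0)
      ∂(Measure.pi fun _ : Fin m => P) = cdf' P x := by
    rw [← integral_ite_le]
    exact integral_comp_eval (μ := fun _ : Fin m => P) (i := i)
      (measurable_ite_le_left x).aestronglyMeasurable
  unfold empCDF
  rw [integral_const_mul, integral_finsetSum _
    fun i _ => (memLp_ite_le_eval P i x).integrable one_le_two]
  simp only [h, Finset.sum_const, Finset.card_univ, Fintype.card_fin, nsmul_eq_mul]
  field_simp

lemma variance_empCDF (P : Measure ℝ) [IsProbabilityMeasure P] (m : ℕ) (x : ℝ) :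
    variance (fun X => empCDF X x) (Measure.pi fun _ : Fin m => P)
      = (m : ℝ)⁻¹ * (cdf' P x * (1 - cdf' P x)) := by
  have h := variance_sum_pi (μ := fun _ : Fin m => P)
    (X := fun _ y => if y ≤ x then (1 : ℝ) else 0) fun _ => memLp_ite_le P x
  simp only [variance_ite_le, Finset.sum_const, Finset.card_univ, Fintype.card_fin,
    nsmul_eq_mul, Finset.sum_fn] at h
  unfold empCDF
  rw [variance_const_mul, h]
  rcases eq_or_ne m 0 with rfl | hm
  · simp
  · field_simp

lemma integral_sub_const_sq {Ω : Type*} [MeasurableSpace Ω] {μ : Measure Ω}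
    [IsProbabilityMeasure μ] {Y : Ω → ℝ} (hY : MemLp Y 2 μ) (c : ℝ) :
    ∫ ω, (Y ω - c) ^ 2 ∂μ = (∫ ω, Y ω ∂μ - c) ^ 2 + variance Y μ := by
  have h := variance_eq_sub (hY.sub (memLp_const c))
  have hv := variance_sub_const hY.aestronglyMeasurable c
  have hi := integral_sub (hY.integrable one_le_two) (integrable_const (μ := μ) c)
  simp only [integral_const, probReal_univ, one_smul] at hi
  simp only [Pi.sub_def, Pi.pow_def] at h
  rw [hv, hi] at h
  linarith

lemma lintegral_empCDF_sub_sq (P : Measure ℝ) [IsProbabilityMeasure P] {m : ℕ} (hm : m ≠ 0)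
    (x c : ℝ) :
    ∫⁻ X, ENNReal.ofReal ((empCDF X x - c) ^ 2) ∂(Measure.pi fun _ : Fin m => P)
      = ENNReal.ofReal ((cdf' P x - c) ^ 2)
        + (m : ℝ≥0∞)⁻¹ * ENNReal.ofReal (cdf' P x * (1 - cdf' P x)) := by
  have hL := memLp_empCDF P m x
  have hp : 0 ≤ cdf' P x * (1 - cdf' P x) :=
    mul_nonneg (cdf'_nonneg P x) (sub_nonneg.2 (cdf'_le_one P x))
  have hi : Integrable (fun X => (empCDF X x - c) ^ 2) (Measure.pi fun _ : Fin m => P) :=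
    (hL.sub (memLp_const c)).integrable_sq
  rw [← ofReal_integral_eq_lintegral_ofReal hi (ae_of_all _ fun _ => sq_nonneg _),
    integral_sub_const_sq hL, integral_empCDF P hm, variance_empCDF,
    ENNReal.ofReal_add (sq_nonneg _) (by positivity), ENNReal.ofReal_mul (by positivity),
    ENNReal.ofReal_inv_of_pos (by positivity), ENNReal.ofReal_natCast]

lemma lintegral_enorm_ite_le_sub (y : ℝ) :
    ∫⁻ x : ℝ, ‖(if (0 : ℝ) ≤ x then (1 : ℝ) else 0) - (if y ≤ x then (1 : ℝ) else 0)‖ₑ = ‖y‖ₑ := by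
  have h : (fun x : ℝ => ‖(if (0 : ℝ) ≤ x then (1 : ℝ) else 0) - (if y ≤ x then (1 : ℝ) else 0)‖ₑ)
      = (Set.Ico (min 0 y) (max 0 y)).indicator 1 := by
    ext x
    rw [Set.indicator_apply]
    simp only [Set.mem_Ico, min_le_iff, lt_max_iff]
    split_ifs <;> first | grind | simp
  rw [h, lintegral_indicator_one measurableSet_Ico, Real.volume_Ico, max_sub_min_eq_abs,
    ← ofReal_norm]
  simp

/-- The distribution function of a law with a finite first moment is `L¹`-close to that of the
unit mass at `0`. -/
lemma lintegral_enorm_ite_sub_cdf'_ne_top (P : Measure ℝ) [IsProbabilityMeasure P]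
    (hP : Integrable (fun x : ℝ => x) P) :
    ∫⁻ x : ℝ, ‖(if (0 : ℝ) ≤ x then (1 : ℝ) else 0) - cdf' P x‖ₑ ≠ ⊤ := by
  have hle (x : ℝ) : ‖(if (0 : ℝ) ≤ x then (1 : ℝ) else 0) - cdf' P x‖ₑ
      ≤ ∫⁻ y, ‖(if (0 : ℝ) ≤ x then (1 : ℝ) else 0) - (if y ≤ x then (1 : ℝ) else 0)‖ₑ ∂P := by
    have hi := integral_sub (integrable_const (μ := P) (if (0 : ℝ) ≤ x then (1 : ℝ) else 0))
      (integrable_ite_le P x)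
    rw [integral_ite_le, integral_const, probReal_univ, one_smul] at hi
    rw [← hi]
    exact enorm_integral_le_lintegral_enorm _
  have hmeas : Measurable fun z : ℝ × ℝ =>
      ‖(if (0 : ℝ) ≤ z.1 then (1 : ℝ) else 0) - (if z.2 ≤ z.1 then (1 : ℝ) else 0)‖ₑ :=
    ((measurable_ite_le.comp (measurable_const.prodMk measurable_fst)).sub
      (measurable_ite_le.comp measurable_swap)).enorm
  refine ((lintegral_mono hle).trans_lt ?_).ne
  rw [lintegral_lintegral_swap hmeas.aemeasurable]
  simp only [lintegral_enorm_ite_le_sub]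
  exact hP.hasFiniteIntegral

lemma lintegral_cdf'_mul_one_sub_ne_top (P : Measure ℝ) [IsProbabilityMeasure P]
    (hP : Integrable (fun x : ℝ => x) P) :
    ∫⁻ x, ENNReal.ofReal (cdf' P x * (1 - cdf' P x)) ≠ ⊤ := by
  refine ne_top_of_le_ne_top (lintegral_enorm_ite_sub_cdf'_ne_top P hP) (lintegral_mono fun x => ?_)
  rw [← ofReal_norm, Real.norm_eq_abs]
  refine ENNReal.ofReal_le_ofReal ?_
  have h0 := cdf'_nonneg P x
  have h1 := cdf'_le_one P x
  split_ifs
  · exact le_trans (by nlinarith) (le_abs_self _)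
  · exact le_trans (by nlinarith) (neg_le_abs _)

lemma lintegral_cdf'_sub_sq_ne_top (P Q : Measure ℝ) [IsProbabilityMeasure P]
    [IsProbabilityMeasure Q] (hP : Integrable (fun x : ℝ => x) P)
    (hQ : Integrable (fun x : ℝ => x) Q) :
    ∫⁻ x, ENNReal.ofReal ((cdf' P x - cdf' Q x) ^ 2) ≠ ⊤ := by
  have hmeas : Measurable fun x : ℝ => ‖(if (0 : ℝ) ≤ x then (1 : ℝ) else 0) - cdf' P x‖ₑ :=
    ((measurable_ite_le.comp (measurable_const.prodMk measurable_id)).sub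
      (monotone_cdf' P).measurable).enorm
  refine ne_top_of_le_ne_top (ENNReal.add_ne_top.2 ⟨lintegral_enorm_ite_sub_cdf'_ne_top P hP,
    lintegral_enorm_ite_sub_cdf'_ne_top Q hQ⟩) ?_
  rw [← lintegral_add_left hmeas]
  refine lintegral_mono fun x => ?_
  rw [← ofReal_norm, ← ofReal_norm,
    ← ENNReal.ofReal_add (norm_nonneg _) (norm_nonneg _), Real.norm_eq_abs, Real.norm_eq_abs]
  refine ENNReal.ofReal_le_ofReal ?_
  have habs : |cdf' P x - cdf' Q x| ≤ 1 := by
    rw [abs_le]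
    constructor <;>
      linarith [cdf'_nonneg P x, cdf'_le_one P x, cdf'_nonneg Q x, cdf'_le_one Q x]
  calc (cdf' P x - cdf' Q x) ^ 2 = |cdf' P x - cdf' Q x| ^ 2 := (sq_abs _).symm
    _ ≤ |cdf' P x - cdf' Q x| := pow_le_of_le_one (abs_nonneg _) habs two_ne_zero
    _ ≤ |cdf' P x - (if (0 : ℝ) ≤ x then (1 : ℝ) else 0)|
          + |(if (0 : ℝ) ≤ x then (1 : ℝ) else 0) - cdf' Q x| := abs_sub_le _ _ _
    _ = _ := by rw [abs_sub_comm (cdf' P x)]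

end

/-- Unbiasedness of the Cramér distance (strong form): for `P, Q` with finite first moments
and `X₁, …, X_m` i.i.d. from `P`,
`E[∫ (F̂_m - F_Q)²] = ∫ (F_P - F_Q)² + (1/m) ∫ F_P (1 - F_P)`, all integrals being finite.
The expected sample Cramér loss thus differs from the true loss by a `Q`-independent term,
so the Cramér distance has unbiased sample gradients. -/
theorem cramer_unbiased (P Q : Measure ℝ) [IsProbabilityMeasure P] [IsProbabilityMeasure Q]
    (hP : Integrable (fun x : ℝ => x) P) (hQ : Integrable (fun x : ℝ => x) Q)
    (m : ℕ) (hm : 1 ≤ m) :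
    (∫⁻ X, (∫⁻ x, ENNReal.ofReal ((empCDF X x - cdf' Q x) ^ 2))
          ∂(Measure.pi fun _ : Fin m => P))
      = (∫⁻ x, ENNReal.ofReal ((cdf' P x - cdf' Q x) ^ 2))
        + (m : ℝ≥0∞)⁻¹ * ∫⁻ x, ENNReal.ofReal (cdf' P x * (1 - cdf' P x))
    ∧ (∫⁻ X, (∫⁻ x, ENNReal.ofReal ((empCDF X x - cdf' Q x) ^ 2))
          ∂(Measure.pi fun _ : Fin m => P)) ≠ ⊤
    ∧ (∫⁻ x, ENNReal.ofReal ((cdf' P x - cdf' Q x) ^ 2)) ≠ ⊤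
    ∧ (∫⁻ x, ENNReal.ofReal (cdf' P x * (1 - cdf' P x))) ≠ ⊤ := by
  have hm0 : m ≠ 0 := by lia
  have hPQ := lintegral_cdf'_sub_sq_ne_top P Q hP hQ
  have hPP := lintegral_cdf'_mul_one_sub_ne_top P hP
  have hP_meas := (monotone_cdf' P).measurable
  have hQ_meas := (monotone_cdf' Q).measurable
  have hmeas : Measurable fun z : (Fin m → ℝ) × ℝ =>
      ENNReal.ofReal ((empCDF z.1 z.2 - cdf' Q z.2) ^ 2) :=
    (((measurable_uncurry_empCDF m).sub (hQ_meas.comp measurable_snd)).pow_const 2).ennreal_ofReal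
  have key : (∫⁻ X, (∫⁻ x, ENNReal.ofReal ((empCDF X x - cdf' Q x) ^ 2))
        ∂(Measure.pi fun _ : Fin m => P))
      = (∫⁻ x, ENNReal.ofReal ((cdf' P x - cdf' Q x) ^ 2))
        + (m : ℝ≥0∞)⁻¹ * ∫⁻ x, ENNReal.ofReal (cdf' P x * (1 - cdf' P x)) := by
    rw [lintegral_lintegral_swap hmeas.aemeasurable]
    simp only [lintegral_empCDF_sub_sq P hm0]
    rw [lintegral_add_left (by fun_prop), lintegral_const_mul _ (by fun_prop)]
  refine ⟨key, ?_, hPQ, hPP⟩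
  rw [key]
  exact ENNReal.add_ne_top.2 ⟨hPQ, ENNReal.mul_ne_top (by simpa using hm0) hPP⟩
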